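/- arXiv:1902.04714 — 3 statements merged into one kernel-verified Lean document; each statement's English description precedes it below -/
import Mathlib

section
/- Let σ < 1, τ > 0 with τ > σ, and c > 0, and let ρ(w) = (Γ(τ−σ)/Γ(1−σ)) w^{−1−σ}(c+w)^{σ−τ} for w > 0. Then the tail Lévy intensity ρ̄(x) = ∫_x^∞ ρ(w) dw is finite for every x > 0 and satisfies ρ̄(x)/( (Γ(τ−σ)/(τ Γ(1−σ))) x^{−τ} ) → 1 as x → ∞. -/
open MeasureTheory Real Filter Set

/-- On `(x, ∞)` the integrand `w ^ (-1 - σ) * (c + w) ^ (σ - τ)` is at most `w ^ (-1 - τ)`. -/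
theorem rpow_mul_add_rpow_le {σ τ c w : ℝ} (hστ : σ < τ) (hc : 0 < c) (hw : 0 < w) :
    w ^ (-1 - σ) * (c + w) ^ (σ - τ) ≤ w ^ (-1 - τ) := by
  have h : w ^ (-1 - τ) = w ^ (-1 - σ) * w ^ (σ - τ) := by
    rw [← Real.rpow_add hw]; ring_nf
  rw [h]
  exact mul_le_mul_of_nonneg_left
    (Real.rpow_le_rpow_of_nonpos hw (by linarith) (by linarith)) (by positivity)

theorem mul_rpow_le_rpow_mul_add_rpow {σ τ c x w : ℝ} (hστ : σ < τ) (hc : 0 < c)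
    (hx : 0 < x) (hxw : x ≤ w) :
    (1 + c / x) ^ (σ - τ) * w ^ (-1 - τ) ≤ w ^ (-1 - σ) * (c + w) ^ (σ - τ) := by
  have hw : 0 < w := hx.trans_le hxw
  have h : w ^ (-1 - τ) = w ^ (-1 - σ) * w ^ (σ - τ) := by
    rw [← Real.rpow_add hw]; ring_nf
  have hle : c + w ≤ (1 + c / x) * w := by
    have : c ≤ c / x * w := by
      rw [div_mul_eq_mul_div, le_div_iff₀ hx]; gcongr
    linarith
  rw [h, mul_left_comm, ← Real.mul_rpow (by positivity) hw.le]
  exact mul_le_mul_of_nonneg_left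
    (Real.rpow_le_rpow_of_nonpos (by positivity) hle (by linarith)) (by positivity)

theorem integrableOn_Ioi_rpow_mul_add_rpow {σ τ c x : ℝ} (hτ0 : 0 < τ) (hστ : σ < τ)
    (hc : 0 < c) (hx : 0 < x) :
    IntegrableOn (fun w : ℝ => w ^ (-1 - σ) * (c + w) ^ (σ - τ)) (Set.Ioi x) := by
  refine Integrable.mono' (integrableOn_Ioi_rpow_of_lt (by linarith : -1 - τ < -1) hx)
    (by fun_prop) ?_
  filter_upwards [ae_restrict_mem measurableSet_Ioi] with w hw
  have hw0 : 0 < w := hx.trans hw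
  rw [Real.norm_of_nonneg (by positivity)]
  exact rpow_mul_add_rpow_le hστ hc hw0

theorem integral_Ioi_rpow_neg_one_sub {τ x : ℝ} (hτ0 : 0 < τ) (hx : 0 < x) :
    ∫ w in Set.Ioi x, w ^ (-1 - τ) = x ^ (-τ) / τ := by
  rw [integral_Ioi_rpow_of_lt (by linarith) hx, show -1 - τ + 1 = -τ by ring, neg_div_neg_eq]

/-- The integral of `w ^ (-1 - σ) * (c + w) ^ (σ - τ)` over `(x, ∞)` is asymptotic to
`x ^ (-τ) / τ` as `x → ∞`. -/
theorem tendsto_integral_Ioi_rpow_mul_add_rpow_div {σ τ c : ℝ} (hτ0 : 0 < τ) (hστ : σ < τ)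
    (hc : 0 < c) :
    Tendsto (fun x : ℝ =>
        (∫ w in Set.Ioi x, w ^ (-1 - σ) * (c + w) ^ (σ - τ)) / (x ^ (-τ) / τ))
      atTop (nhds 1) := by
  have hlim : Tendsto (fun x : ℝ => (1 + c / x) ^ (σ - τ)) atTop (nhds 1) := by
    have h : Tendsto (fun x : ℝ => 1 + c / x) atTop (nhds 1) := by
      simpa using (tendsto_const_nhds (x := c).div_atTop tendsto_id).const_add 1
    simpa using h.rpow_const (p := σ - τ) (Or.inl one_ne_zero)
  refine tendsto_of_tendsto_of_tendsto_of_le_of_le' hlim tendsto_const_nhds ?_ ?_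
  all_goals
    filter_upwards [eventually_gt_atTop 0] with x hx
    have hint := integrableOn_Ioi_rpow_mul_add_rpow hτ0 hστ hc hx
    have hpow := integrableOn_Ioi_rpow_of_lt (by linarith : -1 - τ < -1) hx
  · rw [le_div_iff₀ (by positivity), ← integral_Ioi_rpow_neg_one_sub hτ0 hx,
      ← integral_const_mul]
    exact setIntegral_mono_on (hpow.const_mul _) hint measurableSet_Ioi
      fun w hw => mul_rpow_le_rpow_mul_add_rpow hστ hc hx (le_of_lt hw)
  · rw [div_le_one (by positivity), ← integral_Ioi_rpow_neg_one_sub hτ0 hx]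
    exact setIntegral_mono_on hint hpow measurableSet_Ioi
      fun w hw => rpow_mul_add_rpow_le hστ hc (hx.trans hw)

/-- **Tail of the beta prime Lévy intensity at infinity.** For `σ < 1`, `τ > 0` with
`τ > σ`, `c > 0` and `ρ(w) = (Γ(τ−σ)/Γ(1−σ)) w^{−1−σ}(c+w)^{σ−τ}`, the tail
`ρ̄(x) = ∫_x^∞ ρ(w) dw` is finite for every `x > 0` and
`ρ̄(x) ~ (Γ(τ−σ)/(τ Γ(1−σ))) x^{−τ}` as `x → ∞`. -/
theorem beta_prime_tail_levy_intensity_atTop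
    (σ τ c : ℝ) (hσ : σ < 1) (hτ0 : 0 < τ) (hστ : σ < τ) (hc : 0 < c) :
    (∀ x : ℝ, 0 < x → IntegrableOn
      (fun w => Real.Gamma (τ - σ) / Real.Gamma (1 - σ) * w ^ (-1 - σ) * (c + w) ^ (σ - τ))
      (Set.Ioi x)) ∧
    Tendsto
      (fun x : ℝ =>
        (∫ w in Set.Ioi x,
            Real.Gamma (τ - σ) / Real.Gamma (1 - σ) * w ^ (-1 - σ) * (c + w) ^ (σ - τ)) /
          (Real.Gamma (τ - σ) / (τ * Real.Gamma (1 - σ)) * x ^ (-τ)))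
      atTop (nhds 1) := by
  have hΓ₁ : Real.Gamma (τ - σ) ≠ 0 := (Real.Gamma_pos_of_pos (by linarith)).ne'
  have hΓ₂ : Real.Gamma (1 - σ) ≠ 0 := (Real.Gamma_pos_of_pos (by linarith)).ne'
  simp_rw [mul_assoc (Real.Gamma (τ - σ) / Real.Gamma (1 - σ)), integral_const_mul]
  refine ⟨fun x hx => (integrableOn_Ioi_rpow_mul_add_rpow hτ0 hστ hc hx).const_mul _, ?_⟩
  refine (tendsto_integral_Ioi_rpow_mul_add_rpow_div hτ0 hστ hc).congr' ?_
  filter_upwards [eventually_gt_atTop 0] with x hx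
  have hxτ : x ^ (-τ) ≠ 0 := (Real.rpow_pos_of_pos hx _).ne'
  field_simp
end

section
/- Let κ > 0, α > 0 and let m ≥ α be real. Then ∫_0^∞ w^m · (α/Γ(κ)) w^{−α−1} γ(κ+α, w) dw = ∞. That is, the m-th moment of the generalized BFRY distribution is infinite for m ≥ α. -/
open MeasureTheory Real Filter Set

/-- The lower incomplete gamma function `γ(s,x) = ∫_0^x u^{s−1} e^{−u} du`. -/
noncomputable def lowerIncGamma (s x : ℝ) : ℝ :=
  ∫ u in (0:ℝ)..x, u ^ (s - 1) * Real.exp (-u)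

theorem intervalIntegrable_rpow_mul_exp_neg {s x : ℝ} (hs : 0 < s) (hx : 0 ≤ x) :
    IntervalIntegrable (fun u : ℝ => u ^ (s - 1) * Real.exp (-u)) volume 0 x := by
  rw [intervalIntegrable_iff_integrableOn_Ioc_of_le hx]
  simpa only [mul_comm] using
    (Real.GammaIntegral_convergent hs).mono_set Ioc_subset_Ioi_self

theorem lowerIncGamma_pos {s x : ℝ} (hs : 0 < s) (hx : 0 < x) : 0 < lowerIncGamma s x :=
  intervalIntegral.intervalIntegral_pos_of_pos_on
    (intervalIntegrable_rpow_mul_exp_neg hs hx.le)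
    (fun _ hu => mul_pos (Real.rpow_pos_of_pos hu.1 _) (Real.exp_pos _)) hx

theorem lowerIncGamma_le_lowerIncGamma {s x y : ℝ} (hs : 0 < s) (hx : 0 ≤ x) (hxy : x ≤ y) :
    lowerIncGamma s x ≤ lowerIncGamma s y := by
  refine intervalIntegral.integral_mono_interval le_rfl hx hxy ?_
    (intervalIntegrable_rpow_mul_exp_neg hs (hx.trans hxy))
  filter_upwards [ae_restrict_mem measurableSet_Ioc] with u hu
  exact mul_nonneg (Real.rpow_nonneg hu.1.le _) (Real.exp_pos _).le

theorem lintegral_Ioi_ofReal_inv_eq_top {a : ℝ} (ha : 0 ≤ a) :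
    ∫⁻ w in Ioi a, ENNReal.ofReal w⁻¹ = ⊤ := by
  by_contra h
  refine not_integrableOn_Ioi_inv (a := a) ⟨measurable_inv.aestronglyMeasurable, ?_⟩
  rw [hasFiniteIntegral_iff_ofReal]
  · exact lt_top_iff_ne_top.mpr h
  · filter_upwards [ae_restrict_mem measurableSet_Ioi] with w hw
    exact inv_nonneg.mpr (ha.trans (le_of_lt hw))

/-- **Infinite moments of the generalized BFRY distribution.** For `κ, α > 0` and real
`m ≥ α`, the `m`-th moment `∫_0^∞ w^m (α/Γ(κ)) w^{−α−1} γ(κ+α, w) dw` is infinite. -/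
theorem gbfry_distribution_moment_infinite
    (κ α m : ℝ) (hκ : 0 < κ) (hα : 0 < α) (hm : α ≤ m) :
    ∫⁻ w in Set.Ioi (0:ℝ),
        ENNReal.ofReal (w ^ m * (α / Real.Gamma κ * w ^ (-α - 1) * lowerIncGamma (κ + α) w)) =
      ⊤ := by
  have hs : 0 < κ + α := add_pos hκ hα
  have hA : 0 < α / Real.Gamma κ := div_pos hα (Real.Gamma_pos_of_pos hκ)
  set c := α / Real.Gamma κ * lowerIncGamma (κ + α) 1
  have hc_pos : 0 < c := mul_pos hA (lowerIncGamma_pos hs one_pos)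
  have key : ∀ w ∈ Ioi (1 : ℝ), ENNReal.ofReal c * ENNReal.ofReal w⁻¹ ≤
      ENNReal.ofReal
        (w ^ m * (α / Real.Gamma κ * w ^ (-α - 1) * lowerIncGamma (κ + α) w)) := by
    intro w hw
    have hw1 : (1 : ℝ) ≤ w := le_of_lt hw
    have hw0 : 0 < w := one_pos.trans_le hw1
    rw [← ENNReal.ofReal_mul hc_pos.le]
    refine ENNReal.ofReal_le_ofReal ?_
    have hpow : w⁻¹ ≤ w ^ m * w ^ (-α - 1) := by
      rw [← Real.rpow_add hw0, ← Real.rpow_neg_one]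
      exact Real.rpow_le_rpow_of_exponent_le hw1 (by linarith)
    calc c * w⁻¹
        ≤ (α / Real.Gamma κ * lowerIncGamma (κ + α) w) * (w ^ m * w ^ (-α - 1)) :=
          mul_le_mul
            (mul_le_mul_of_nonneg_left
              (lowerIncGamma_le_lowerIncGamma hs zero_le_one hw1) hA.le)
            hpow (inv_nonneg.mpr hw0.le) (mul_pos hA (lowerIncGamma_pos hs hw0)).le
      _ = _ := by ring
  rw [eq_top_iff]
  calc ⊤ = ENNReal.ofReal c * ∫⁻ w in Ioi (1 : ℝ), ENNReal.ofReal w⁻¹ := by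
        rw [lintegral_Ioi_ofReal_inv_eq_top zero_le_one,
          ENNReal.mul_top (ENNReal.ofReal_pos.mpr hc_pos).ne']
    _ = ∫⁻ w in Ioi (1 : ℝ), ENNReal.ofReal c * ENNReal.ofReal w⁻¹ :=
        (lintegral_const_mul _ measurable_inv.ennreal_ofReal).symm
    _ ≤ ∫⁻ w in Ioi (1 : ℝ), ENNReal.ofReal
          (w ^ m * (α / Real.Gamma κ * w ^ (-α - 1) * lowerIncGamma (κ + α) w)) :=
        setLIntegral_mono' measurableSet_Ioi key
    _ ≤ _ := lintegral_mono_set (Ioi_subset_Ioi zero_le_one)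
end

section
/- Let σ < 1, τ > max(0,σ), c > 0, t > 0 and let m > σ be real, and let ρ(w) = w^{−1−τ} γ(τ−σ, cw)/Γ(1−σ) for w > 0. Then ∫_0^∞ w^m e^{−tw} ρ(w) dw = (Γ(m−σ)/Γ(1−σ)) ∫_0^c y^{τ−σ−1} (y+t)^{σ−m} dy, and both integrals are finite. -/
open MeasureTheory Real Filter Set

/-- The Gamma integrand `x ^ (a - 1) * exp (-(r * x))` is integrable on the positive half-line. -/
theorem integrableOn_rpow_mul_exp_neg_mul_Ioi {a r : ℝ} (ha : 0 < a) (hr : 0 < r) :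
    IntegrableOn (fun x : ℝ => x ^ (a - 1) * Real.exp (-(r * x))) (Set.Ioi 0) := by
  have h := integrableOn_rpow_mul_exp_neg_mul_rpow (p := 1) (s := a - 1) (by linarith) one_pos hr
  simpa only [Real.rpow_one, neg_mul] using h

/-- Rescaling the lower incomplete gamma function to an integral over a fixed interval. -/
theorem lowerIncGamma_mul (s : ℝ) {c w : ℝ} (hc : 0 ≤ c) (hw : 0 < w) :
    lowerIncGamma s (c * w) =
      w ^ s * ∫ y in Set.Ioc 0 c, y ^ (s - 1) * Real.exp (-(w * y)) := by
  have h := intervalIntegral.mul_integral_comp_mul_left (a := 0) (b := c)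
    (f := fun u : ℝ => u ^ (s - 1) * Real.exp (-u)) w
  rw [mul_zero, mul_comm w c] at h
  rw [lowerIncGamma, ← h, intervalIntegral.integral_of_le hc, ← integral_const_mul,
    ← integral_const_mul]
  refine setIntegral_congr_fun measurableSet_Ioc fun y hy => ?_
  rw [Real.mul_rpow hw.le hy.1.le, Real.rpow_sub_one hw.ne']
  field_simp

/-- The moment kernel `y ^ (s - 1) * (y + t) ^ b` is integrable on `(0, c]`. -/
theorem integrableOn_rpow_mul_add_rpow_Ioc {s t c : ℝ} (b : ℝ) (hs : 0 < s) (ht : 0 < t)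
    (hc : 0 ≤ c) :
    IntegrableOn (fun y : ℝ => y ^ (s - 1) * (y + t) ^ b) (Set.Ioc 0 c) := by
  rw [← intervalIntegrable_iff_integrableOn_Ioc_of_le hc]
  refine (intervalIntegral.intervalIntegrable_rpow' (by linarith)).mul_continuousOn ?_
  rw [Set.uIcc_of_le hc]
  exact (continuousOn_id.add continuousOn_const).rpow_const fun y hy =>
    Or.inl (add_pos_of_nonneg_of_pos hy.1 ht).ne'

/-- Integrating the joint density in the first variable gives a Gamma value. -/
theorem integral_Ioi_rpow_mul_rpow_mul_exp {a t y : ℝ} (b : ℝ) (ha : 0 < a) (hyt : 0 < y + t) :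
    ∫ w in Set.Ioi (0:ℝ), y ^ b * (w ^ (a - 1) * Real.exp (-((y + t) * w))) =
      Real.Gamma a * (y ^ b * (y + t) ^ (-a)) := by
  rw [integral_const_mul, Real.integral_rpow_mul_exp_neg_mul_Ioi ha hyt, one_div,
    Real.inv_rpow hyt.le, Real.rpow_neg hyt.le]
  ring

/-- The joint density `y ^ (s - 1) * w ^ (a - 1) * exp (-((y + t) * w))` is integrable. -/
theorem integrable_prod_rpow_mul_rpow_mul_exp {a s t c : ℝ} (ha : 0 < a) (hs : 0 < s)
    (ht : 0 < t) (hc : 0 ≤ c) :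
    Integrable (fun p : ℝ × ℝ =>
        p.2 ^ (s - 1) * (p.1 ^ (a - 1) * Real.exp (-((p.2 + t) * p.1))))
      ((volume.restrict (Set.Ioi 0)).prod (volume.restrict (Set.Ioc 0 c))) := by
  rw [integrable_prod_iff' (Measurable.aestronglyMeasurable (by fun_prop))]
  constructor
  · filter_upwards [ae_restrict_mem measurableSet_Ioc] with y hy
    exact (integrableOn_rpow_mul_exp_neg_mul_Ioi ha (add_pos hy.1 ht)).const_mul _
  · refine ((integrableOn_rpow_mul_add_rpow_Ioc (-a) hs ht hc).const_mul (Real.Gamma a)).congr ?_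
    filter_upwards [ae_restrict_mem measurableSet_Ioc] with y hy
    rw [← integral_Ioi_rpow_mul_rpow_mul_exp _ ha (add_pos hy.1 ht)]
    refine setIntegral_congr_fun measurableSet_Ioi fun w hw => ?_
    have hw' : 0 < w := hw
    have hy' : 0 < y := hy.1
    exact (Real.norm_of_nonneg (by positivity)).symm

/-- **Moment integral of the generalized BFRY Lévy density.** For `σ < 1`, `τ > max(0,σ)`,
`c > 0`, `t > 0`, real `m > σ` and `ρ(w) = w^{−1−τ} γ(τ−σ, cw)/Γ(1−σ)`,
`∫_0^∞ w^m e^{−tw} ρ(w) dw = (Γ(m−σ)/Γ(1−σ)) ∫_0^c y^{τ−σ−1} (y+t)^{σ−m} dy`,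
and both integrals are finite. -/
theorem gbfry_kappa_integral
    (σ τ c t m : ℝ) (hσ : σ < 1) (hτ : max 0 σ < τ) (hc : 0 < c) (ht : 0 < t) (hm : σ < m) :
    IntegrableOn
      (fun w => w ^ m * Real.exp (-(t * w)) *
        (w ^ (-1 - τ) * lowerIncGamma (τ - σ) (c * w) / Real.Gamma (1 - σ)))
      (Set.Ioi 0) ∧
    IntegrableOn (fun y => y ^ (τ - σ - 1) * (y + t) ^ (σ - m)) (Set.Ioc 0 c) ∧
    ∫ w in Set.Ioi (0:ℝ),
        w ^ m * Real.exp (-(t * w)) *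
          (w ^ (-1 - τ) * lowerIncGamma (τ - σ) (c * w) / Real.Gamma (1 - σ)) =
      Real.Gamma (m - σ) / Real.Gamma (1 - σ) *
        ∫ y in Set.Ioc (0:ℝ) c, y ^ (τ - σ - 1) * (y + t) ^ (σ - m) := by
  have hs : 0 < τ - σ := sub_pos.2 ((le_max_right 0 σ).trans_lt hτ)
  have ha : 0 < m - σ := sub_pos.2 hm
  have hprod := integrable_prod_rpow_mul_rpow_mul_exp ha hs ht hc.le
  have hfiber : EqOn
      (fun w => w ^ m * Real.exp (-(t * w)) *
        (w ^ (-1 - τ) * lowerIncGamma (τ - σ) (c * w) / Real.Gamma (1 - σ)))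
      (fun w => (∫ y in Set.Ioc 0 c,
        y ^ (τ - σ - 1) * (w ^ (m - σ - 1) * Real.exp (-((y + t) * w)))) / Real.Gamma (1 - σ))
      (Set.Ioi 0) := by
    intro w (hw : 0 < w)
    have hpow : w ^ (m - σ - 1) = w ^ m * w ^ (-1 - τ) * w ^ (τ - σ) := by
      rw [← Real.rpow_add hw, ← Real.rpow_add hw]
      ring_nf
    have hfactor : ∀ y : ℝ,
        y ^ (τ - σ - 1) * (w ^ (m - σ - 1) * Real.exp (-((y + t) * w))) =
          w ^ (m - σ - 1) * Real.exp (-(t * w)) *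
            (y ^ (τ - σ - 1) * Real.exp (-(w * y))) := by
      intro y
      rw [show -((y + t) * w) = -(t * w) + -(w * y) by ring, Real.exp_add]
      ring
    simp only [hfactor]
    rw [integral_const_mul, lowerIncGamma_mul _ hc.le hw, hpow]
    ring
  refine ⟨?_, integrableOn_rpow_mul_add_rpow_Ioc _ hs ht hc.le, ?_⟩
  · exact IntegrableOn.congr_fun (hprod.integral_prod_left.div_const _) hfiber.symm
      measurableSet_Ioi
  · rw [setIntegral_congr_fun measurableSet_Ioi hfiber, integral_div,
      integral_integral_swap hprod, div_mul_eq_mul_div, ← integral_const_mul]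
    congr 1
    refine setIntegral_congr_fun measurableSet_Ioc fun y hy => ?_
    rw [integral_Ioi_rpow_mul_rpow_mul_exp _ ha (add_pos hy.1 ht), neg_sub]
end
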